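/- Let G be the simple graph whose vertex set is the collection of 2-element subsets of a 5-element set, with two vertices adjacent if and only if the corresponding subsets are disjoint (this is the Petersen graph, the incidence graph of the 10 lines on a quintic Del Pezzo surface). Then the natural group homomorphism from the symmetric group S5 to the automorphism group of G, induced by the action of S5 on 2-element subsets, is an isomorphism of groups. In particular, the automorphism group of the Petersen graph is isomorphic to S5. -/

import Mathlib

/-- The Petersen graph: vertices are the 2-element subsets of a 5-element set, with two
vertices adjacent iff the corresponding subsets are disjoint.  This is the incidence graph
of the 10 lines on a quintic Del Pezzo surface. -/
def petersenGraph : SimpleGraph {s : Finset (Fin 5) // s.card = 2} where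
  Adj a b := Disjoint a.1 b.1
  symm := ⟨fun a b h => h.symm⟩
  loopless := by
    refine ⟨?_⟩
    intro a h
    have h2 : a.1 = ⊥ := disjoint_self.mp h
    have := a.2
    rw [h2] at this
    simp at this

abbrev PV := {s : Finset (Fin 5) // s.card = 2}

set_option synthInstance.maxHeartbeats 400000 in
set_option synthInstance.maxSize 4000 in
set_option maxRecDepth 100000 in
/-- Four distinct pairwise intersecting pairs have a common element. -/
theorem common_elt : ∀ a ∈ Finset.powersetCard 2 (Finset.univ : Finset (Fin 5)),
    ∀ b ∈ Finset.powersetCard 2 (Finset.univ : Finset (Fin 5)), (a ≠ b ∧ ¬ Disjoint a b) →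
    ∀ c ∈ Finset.powersetCard 2 (Finset.univ : Finset (Fin 5)),
      (a ≠ c ∧ ¬ Disjoint a c ∧ b ≠ c ∧ ¬ Disjoint b c) →
    ∀ d ∈ Finset.powersetCard 2 (Finset.univ : Finset (Fin 5)),
      (a ≠ d ∧ ¬ Disjoint a d ∧ b ≠ d ∧ ¬ Disjoint b d ∧ c ≠ d ∧ ¬ Disjoint c d) →
    ∃ j, j ∈ a ∧ j ∈ b ∧ j ∈ c ∧ j ∈ d := by
  decide +kernel

def mkPair (i k : Fin 5) (h : i ≠ i + k) : PV := ⟨{i, i + k}, Finset.card_pair h⟩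

theorem pair_eq : ∀ i : Fin 5, ∀ s ∈ Finset.powersetCard 2 (Finset.univ : Finset (Fin 5)),
    i ∈ s → s = {i, i+1} ∨ s = {i, i+2} ∨ s = {i, i+3} ∨ s = {i, i+4} := by
  set_option maxRecDepth 100000 in
  decide

theorem image_star (f : petersenGraph ≃g petersenGraph) (i : Fin 5) :
    ∃ j, ∀ s : PV, i ∈ s.1 → j ∈ (f s).1 := by
  have mem : ∀ s : PV, s.1 ∈ Finset.powersetCard 2 (Finset.univ : Finset (Fin 5)) := by
    intro s; simp [Finset.mem_powersetCard, s.2]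
  have key : ∀ s t : PV, i ∈ s.1 → i ∈ t.1 → s.1 ≠ t.1 →
      (f s).1 ≠ (f t).1 ∧ ¬ Disjoint (f s).1 (f t).1 := by
    intro s t hs ht hne
    refine ⟨fun h => hne (congrArg _ (f.injective (Subtype.ext h))), fun h => ?_⟩
    have h2 : petersenGraph.Adj s t := f.map_rel_iff.mp h
    exact Finset.disjoint_left.mp h2 hs ht
  have h1 : i ≠ i + 1 := (by decide : ∀ i : Fin 5, i ≠ i + 1) i
  have h2 : i ≠ i + 2 := (by decide : ∀ i : Fin 5, i ≠ i + 2) i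
  have h3 : i ≠ i + 3 := (by decide : ∀ i : Fin 5, i ≠ i + 3) i
  have h4 : i ≠ i + 4 := (by decide : ∀ i : Fin 5, i ≠ i + 4) i
  have m : ∀ k h, i ∈ (mkPair i k h).1 := by intro k h; simp [mkPair]
  have ne : ∀ k l h h', k ≠ l → (mkPair i k h).1 ≠ (mkPair i l h').1 := by
    intro k l h h' hkl he
    have : i + k ∈ (mkPair i l h').1 := by rw [← he]; simp [mkPair]
    simp only [mkPair, Finset.mem_insert, Finset.mem_singleton] at this
    rcases this with e | e
    · exact h e.symm
    · exact hkl (add_left_cancel e)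
  have K := fun k l h h' hkl => key (mkPair i k h) (mkPair i l h') (m k h) (m l h') (ne k l h h' hkl)
  have k12 := K 1 2 h1 h2 (by decide)
  have k13 := K 1 3 h1 h3 (by decide)
  have k14 := K 1 4 h1 h4 (by decide)
  have k23 := K 2 3 h2 h3 (by decide)
  have k24 := K 2 4 h2 h4 (by decide)
  have k34 := K 3 4 h3 h4 (by decide)
  obtain ⟨j, ja, jb, jc, jd⟩ := common_elt _ (mem _) _ (mem _) k12 _ (mem _)
    ⟨k13.1, k13.2, k23.1, k23.2⟩ _ (mem _) ⟨k14.1, k14.2, k24.1, k24.2, k34.1, k34.2⟩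
  refine ⟨j, fun s hs => ?_⟩
  rcases pair_eq i s.1 (mem s) hs with e | e | e | e
  · rwa [show s = mkPair i 1 h1 from Subtype.ext e]
  · rwa [show s = mkPair i 2 h2 from Subtype.ext e]
  · rwa [show s = mkPair i 3 h3 from Subtype.ext e]
  · rwa [show s = mkPair i 4 h4 from Subtype.ext e]

/-- An element lying in every pair through `i` is `i`. -/
theorem star_elt (i j : Fin 5) (h : ∀ s : PV, i ∈ s.1 → j ∈ s.1) : j = i := by
  have h1 : i ≠ i + 1 := by clear h; revert i; decide
  have h2 : i ≠ i + 2 := by clear h; revert i; decide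
  have a := h (mkPair i 1 h1) (by simp [mkPair])
  have b := h (mkPair i 2 h2) (by simp [mkPair])
  simp only [mkPair, Finset.mem_insert, Finset.mem_singleton] at a b
  rcases a with a | a
  · exact a
  · rcases b with b | b
    · exact b
    · exact absurd (add_left_cancel (a.symm.trans b)) (by decide)

theorem exists_perm (f : petersenGraph ≃g petersenGraph) :
    ∃ σ : Equiv.Perm (Fin 5), ∀ s : PV, (f s).1 = s.1.image σ := by
  choose σ hσ using image_star f
  choose τ hτ using image_star f.symm
  have l : ∀ i, τ (σ i) = i := fun i => star_elt i _ fun s hs => by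
    simpa using hτ _ _ (hσ i s hs)
  have r : ∀ i, σ (τ i) = i := fun i => star_elt i _ fun s hs => by
    simpa using hσ _ _ (hτ i s hs)
  refine ⟨⟨σ, τ, l, r⟩, fun s => (Finset.eq_of_subset_of_card_le ?_ ?_).symm⟩
  · intro x hx
    obtain ⟨i, hi, rfl⟩ := Finset.mem_image.mp hx
    exact hσ i s hi
  · rw [Finset.card_image_of_injective _ (Equiv.injective _), s.2, (f s).2]

/-- The graph automorphism induced by a permutation. -/
def permAut (σ : Equiv.Perm (Fin 5)) : petersenGraph ≃g petersenGraph where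
  toFun s := ⟨s.1.image σ, by rw [Finset.card_image_of_injective _ σ.injective, s.2]⟩
  invFun s := ⟨s.1.image σ.symm, by rw [Finset.card_image_of_injective _ σ.symm.injective, s.2]⟩
  left_inv s := Subtype.ext (by simp [Finset.image_image])
  right_inv s := Subtype.ext (by simp [Finset.image_image])
  map_rel_iff' {s t} := Finset.disjoint_image σ.injective

def permHom : Equiv.Perm (Fin 5) →* (petersenGraph ≃g petersenGraph) where
  toFun := permAut
  map_one' := RelIso.ext fun s => Subtype.ext (by
    change s.1.image (id : Fin 5 → Fin 5) = s.1
    simp)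
  map_mul' σ τ := RelIso.ext fun s => Subtype.ext (by
    change s.1.image (σ ∘ τ) = (s.1.image τ).image σ
    rw [Finset.image_image])

theorem permHom_bijective : Function.Bijective permHom := by
  constructor
  · rw [injective_iff_map_eq_one]
    intro σ h
    ext1 i
    refine star_elt i _ fun s hs => ?_
    have : s.1.image σ = s.1 := congrArg Subtype.val (DFunLike.congr_fun h s)
    rw [← this]
    exact Finset.mem_image_of_mem _ hs
  · intro f
    obtain ⟨σ, h⟩ := exists_perm f
    exact ⟨σ, RelIso.ext fun s => Subtype.ext (h s).symm⟩

/-- The natural group homomorphism from `S₅` to the automorphism group of the Petersen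
graph, induced by the action of `S₅` on 2-element subsets, is an isomorphism of groups;
in particular the automorphism group of the Petersen graph is isomorphic to `S₅`. -/
theorem stmt_5 :
    ∃ φ : Equiv.Perm (Fin 5) ≃* (petersenGraph ≃g petersenGraph),
      ∀ (σ : Equiv.Perm (Fin 5)) (s : {s : Finset (Fin 5) // s.card = 2}),
        ((φ σ) s).1 = s.1.image σ := by
  exact ⟨MulEquiv.ofBijective permHom permHom_bijective, fun _ _ => rfl⟩
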